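/- Let d, n be positive integers, β ≥ 1, and γ ≥ 0. Let a_1, …, a_n ∈ ℝ^d with ‖a_i‖₂ ≤ β for all i. Let w_1, …, w_n ≥ 0 with ∑_i w_i ≤ d, set M = ∑_i w_i a_i a_iᵀ, assume M is positive definite, and assume the complementary slackness condition: a_iᵀ M⁻¹ a_i = 1 for every i with w_i > 0. Let S be a d×d symmetric positive definite matrix with S⁻¹ ⪯ I_d, and suppose the total weight on points outside the ellipsoid {x : xᵀ S⁻¹ x ≤ 1} satisfies ∑_{i : a_iᵀ S⁻¹ a_i > 1} w_i ≤ γ·d. Then log det(M) ≤ log det(S) + 2γd·log(β). -/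

import Mathlib

open Matrix Real Finset

open scoped MatrixOrder in
/-- Simultaneous diagonalization by congruence of two positive definite real matrices. -/
theorem Matrix.PosDef.exists_transpose_mul_mul_eq_one_and_eq_mul_diagonal_mul
    {m : Type*} [Fintype m] [DecidableEq m] {M P : Matrix m m ℝ}
    (hM : M.PosDef) (hP : P.PosDef) :
    ∃ (B : Matrix m m ℝ) (μ : m → ℝ), (∀ j, 0 < μ j) ∧ Bᵀ * M * B = 1 ∧
      P = B * diagonal μ * Bᵀ := by
  obtain ⟨C, rfl⟩ : ∃ C : Matrix m m ℝ, M = Cᵀ * C := by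
    obtain ⟨C, h⟩ := CStarAlgebra.nonneg_iff_eq_star_mul_self.mp hM.posSemidef.nonneg
    exact ⟨C, h⟩
  have hC : IsUnit C.det := by
    have h := hM.det_pos.ne'
    rw [det_mul, det_transpose] at h
    exact (mul_self_ne_zero.mp h).isUnit
  have hCt : IsUnit Cᵀ.det := by rwa [det_transpose]
  have hG : (C * P * Cᵀ).PosDef := by
    rw [← conjTranspose_eq_transpose_of_trivial]
    exact hP.mul_mul_conjTranspose_same
      (vecMul_injective_iff_isUnit.mpr ((isUnit_iff_isUnit_det C).mpr hC))
  set U : Matrix m m ℝ := (hG.1.eigenvectorUnitary : Matrix m m ℝ)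
  have hU : Uᵀ * U = 1 := Unitary.coe_star_mul_self hG.1.eigenvectorUnitary
  obtain ⟨μ, hμ, hspec⟩ :
      ∃ μ : m → ℝ, (∀ j, 0 < μ j) ∧ C * P * Cᵀ = U * diagonal μ * Uᵀ := by
    refine ⟨hG.1.eigenvalues, hG.eigenvalues_pos, ?_⟩
    have h := hG.1.spectral_theorem
    rw [Unitary.conjStarAlgAut_apply] at h
    exact h
  refine ⟨C⁻¹ * U, μ, hμ, ?_, ?_⟩
  · calc (C⁻¹ * U)ᵀ * (Cᵀ * C) * (C⁻¹ * U)
        = Uᵀ * (C * C⁻¹)ᵀ * (C * C⁻¹) * U := by simp only [transpose_mul, Matrix.mul_assoc]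
      _ = 1 := by simp [mul_nonsing_inv C hC, hU]
  · calc P = C⁻¹ * (C * P * Cᵀ) * (C⁻¹)ᵀ := by
          rw [transpose_nonsing_inv, Matrix.mul_assoc C, nonsing_inv_mul_cancel_left _ _ hC,
            mul_nonsing_inv_cancel_right _ _ hCt]
      _ = C⁻¹ * U * diagonal μ * (C⁻¹ * U)ᵀ := by
          rw [hspec]
          simp only [transpose_mul, Matrix.mul_assoc]

/-- The quadratic form of `B * diagonal μ * Bᵀ` in coordinates. -/
theorem dotProduct_mul_diagonal_mul_transpose_mulVec
    {m : Type*} [Fintype m] [DecidableEq m] (B : Matrix m m ℝ) (μ x : m → ℝ) :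
    x ⬝ᵥ ((B * diagonal μ * Bᵀ) *ᵥ x) = ∑ j, (Bᵀ *ᵥ x) j ^ 2 * μ j := by
  rw [← mulVec_mulVec, ← mulVec_mulVec, dotProduct_mulVec, ← mulVec_transpose]
  simp only [dotProduct, mulVec_diagonal]
  exact Finset.sum_congr rfl fun j _ => by ring

/-- If the weights `w` satisfy complementary slackness for `M = ∑ i, w i • a i (a i)ᵀ`, then
`log det M + log det P` is at most the weighted sum of the logarithms of `(a i)ᵀ P (a i)`. -/
theorem log_det_add_log_det_le_sum_mul_log
    {ι m : Type*} [Fintype ι] [Fintype m] [DecidableEq m]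
    {a : ι → m → ℝ} {w : ι → ℝ} (hw : ∀ i, 0 ≤ w i) {M P : Matrix m m ℝ}
    (hM : M = ∑ i, w i • vecMulVec (a i) (a i)) (hMpd : M.PosDef)
    (hcs : ∀ i, 0 < w i → a i ⬝ᵥ (M⁻¹ *ᵥ a i) = 1) (hP : P.PosDef) :
    log M.det + log P.det ≤ ∑ i, w i * log (a i ⬝ᵥ (P *ᵥ a i)) := by
  obtain ⟨B, μ, hμ, hBM, hBP⟩ :=
    hMpd.exists_transpose_mul_mul_eq_one_and_eq_mul_diagonal_mul hP
  have hMinv : M⁻¹ = B * diagonal 1 * Bᵀ := by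
    rw [Matrix.mul_assoc, mul_eq_one_comm, Matrix.mul_assoc] at hBM
    rw [inv_eq_right_inv hBM, show diagonal (1 : m → ℝ) = 1 from diagonal_one, Matrix.mul_one]
  have hdet : M.det * P.det = ∏ j, μ j := by
    have h := congrArg det hBM
    simp only [det_mul, det_transpose, det_one] at h
    rw [hBP]
    simp only [det_mul, det_transpose, det_diagonal]
    linear_combination (∏ j, μ j) * h
  have hcol (j : m) : ∑ i, w i * (Bᵀ *ᵥ a i) j ^ 2 = 1 := by
    have h := congrFun (congrFun hBM j) j
    rw [hM, Matrix.mul_sum, Matrix.sum_mul, Matrix.sum_apply, one_apply_eq] at h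
    rw [← h]
    refine Finset.sum_congr rfl fun i _ => ?_
    rw [Matrix.mul_smul, Matrix.smul_mul, mul_vecMulVec, vecMulVec_mul, ← mulVec_transpose,
      Matrix.smul_apply, vecMulVec_apply, smul_eq_mul, sq]
  have hjensen (i : ι) :
      w i * ∑ j, (Bᵀ *ᵥ a i) j ^ 2 * log (μ j) ≤ w i * log (a i ⬝ᵥ (P *ᵥ a i)) := by
    rcases (hw i).eq_or_lt with h0 | hpos
    · simp [← h0]
    · refine mul_le_mul_of_nonneg_left ?_ (hw i)
      have hunit := hcs i hpos
      rw [hMinv, dotProduct_mul_diagonal_mul_transpose_mulVec] at hunit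
      rw [hBP, dotProduct_mul_diagonal_mul_transpose_mulVec]
      exact strictConcaveOn_log_Ioi.concaveOn.le_map_sum (fun j _ => sq_nonneg _)
        (by simpa using hunit) fun j _ => hμ j
  calc log M.det + log P.det = ∑ j, log (μ j) := by
        rw [← log_mul hMpd.det_pos.ne' hP.det_pos.ne', hdet, log_prod fun j _ => (hμ j).ne']
    _ = ∑ j, (∑ i, w i * (Bᵀ *ᵥ a i) j ^ 2) * log (μ j) := by simp [hcol]
    _ = ∑ i, w i * ∑ j, (Bᵀ *ᵥ a i) j ^ 2 * log (μ j) := by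
        simp only [Finset.sum_mul, Finset.mul_sum, mul_assoc]
        exact Finset.sum_comm
    _ ≤ _ := Finset.sum_le_sum fun i _ => hjensen i

/-- Origin-centered volume approximation when the dual places little weight on
outliers (Lemma 1.4). Under complementary slackness for `M = ∑ w i • a i a iᵀ`,
if `S⁻¹ ⪯ I` and the total weight on points outside the ellipsoid
`{x : xᵀ S⁻¹ x ≤ 1}` is at most `γ d`, then
`log det M ≤ log det S + 2 γ d log β`. -/
theorem volume_approx_origin_centered
    (d n : ℕ) (hd : 0 < d) (hn : 0 < n)
    (β γ : ℝ) (hβ : 1 ≤ β) (hγ : 0 ≤ γ)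
    (a : Fin n → Fin d → ℝ)
    (ha : ∀ i, Real.sqrt (a i ⬝ᵥ a i) ≤ β)
    (w : Fin n → ℝ) (hw : ∀ i, 0 ≤ w i) (hsum : ∑ i, w i ≤ (d : ℝ))
    (M : Matrix (Fin d) (Fin d) ℝ)
    (hM : M = ∑ i, w i • Matrix.vecMulVec (a i) (a i))
    (hMpd : M.PosDef)
    (hcs : ∀ i, 0 < w i → a i ⬝ᵥ (M⁻¹ *ᵥ a i) = 1)
    (S : Matrix (Fin d) (Fin d) ℝ) (hS : S.PosDef)
    (hScond : ((1 : Matrix (Fin d) (Fin d) ℝ) - S⁻¹).PosSemidef)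
    (hout : ∑ i ∈ Finset.univ.filter (fun i => 1 < a i ⬝ᵥ (S⁻¹ *ᵥ a i)), w i ≤ γ * d) :
    Real.log M.det ≤ Real.log S.det + 2 * γ * d * Real.log β := by
  have hkey := log_det_add_log_det_le_sum_mul_log hw hM hMpd hcs hS.inv
  rw [det_nonsing_inv, Ring.inverse_eq_inv', log_inv] at hkey
  have hquad (i : Fin n) : a i ⬝ᵥ (S⁻¹ *ᵥ a i) ≤ β ^ 2 := by
    have h := hScond.dotProduct_mulVec_nonneg (a i)
    rw [star_trivial, sub_mulVec, one_mulVec, dotProduct_sub] at h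
    have h' := (sqrt_le_left (zero_le_one.trans hβ)).mp (ha i)
    linarith
  have hterm (i : Fin n) : w i * log (a i ⬝ᵥ (S⁻¹ *ᵥ a i)) ≤
      if 1 < a i ⬝ᵥ (S⁻¹ *ᵥ a i) then w i * (2 * log β) else 0 := by
    split_ifs with h
    · refine mul_le_mul_of_nonneg_left ?_ (hw i)
      have h' := log_le_log (zero_lt_one.trans h) (hquad i)
      rwa [log_pow, Nat.cast_ofNat] at h'
    · have h0 := hS.inv.posSemidef.dotProduct_mulVec_nonneg (a i)
      exact mul_nonpos_of_nonneg_of_nonpos (hw i) (log_nonpos h0 (not_lt.mp h))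
  have hbound := Finset.sum_le_sum fun i (_ : i ∈ Finset.univ) => hterm i
  rw [← Finset.sum_filter, ← Finset.sum_mul] at hbound
  have hlast := mul_le_mul_of_nonneg_right hout (mul_nonneg zero_le_two (log_nonneg hβ))
  linarith
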